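/- Let 0 < β < 1 and let λ > 0 (in the RC-circuit interpretation λ = 1/(RC) with resistance R > 0 and capacitance C > 0). For any V_0, the function V(t) = V_0 E_β(−λ t^β) satisfies the fractional relaxation equation D_c^β V(t) + λ V(t) = 0 for all t > 0, together with V(0) = V_0; moreover V(t) equals the Wright-type transform of s ↦ V_0 e^{−λ s}, i.e. V(t) = ∫_0^∞ V_0 e^{−λ x} g_β(x;t) dx. -/

import Mathlib

open MeasureTheory Real Set Filter

/-- The Wright-type density `g_β(x;t) = t^{-β} ∑_{k} (−x/t^β)^k / (k! Γ(1 − β(k+1)))`. -/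
noncomputable def wrightG (β x t : ℝ) : ℝ :=
  t ^ (-β) * ∑' k : ℕ, (-x / t ^ β) ^ k / ((Nat.factorial k : ℝ) * Real.Gamma (1 - β * (k + 1)))

/-- The two-parameter Mittag-Leffler function `E_{β,α}(z) = ∑_k z^k / Γ(βk + α)`. -/
noncomputable def mittagLeffler (β α z : ℝ) : ℝ :=
  ∑' k : ℕ, z ^ k / Real.Gamma (β * k + α)

/-- The Caputo fractional derivative of order `β ∈ (0,1)`:
`D_c^β h(t) = (1/Γ(1−β)) ∫_0^t (t−τ)^{−β} h′(τ) dτ`. -/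
noncomputable def caputo (β : ℝ) (h : ℝ → ℝ) (t : ℝ) : ℝ :=
  (1 / Real.Gamma (1 - β)) * ∫ τ in (0:ℝ)..t, (t - τ) ^ (-β) * deriv h τ

/-- A function is of exponential order on `[0,∞)` if `|h(x)| ≤ C e^{a x}` there. -/
def ExpOrder (h : ℝ → ℝ) : Prop :=
  ∃ C a : ℝ, 0 < C ∧ 0 < a ∧ ∀ x : ℝ, 0 ≤ x → |h x| ≤ C * Real.exp (a * x)

open Topology

lemma integrableOn_rpow_mul_exp_neg_mul {w c : ℝ} (hw : -1 < w) (hc : 0 < c) :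
    IntegrableOn (fun r : ℝ => r ^ w * Real.exp (-c * r)) (Ioi 0) := by
  simpa using integrableOn_rpow_mul_exp_neg_mul_rpow (p := 1) hw one_pos hc

/-- The integrand `r ^ w * exp (-ζ r)` of the Laplace transform of a power. -/
noncomputable def powExp (w : ℝ) (ζ : ℂ) (r : ℝ) : ℂ := ((r ^ w : ℝ) : ℂ) * Complex.exp (-ζ * r)

lemma norm_powExp {w r : ℝ} (hr : 0 < r) (ζ : ℂ) :
    ‖powExp w ζ r‖ = r ^ w * Real.exp (-ζ.re * r) := by
  rw [powExp, norm_mul, Complex.norm_exp, Complex.norm_real, Real.norm_eq_abs,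
    abs_of_nonneg (Real.rpow_nonneg hr.le _)]
  simp

lemma aestronglyMeasurable_powExp (w : ℝ) (ζ : ℂ) :
    AEStronglyMeasurable (powExp w ζ) (volume.restrict (Ioi 0)) := by
  refine ContinuousOn.aestronglyMeasurable (fun r hr => ?_) measurableSet_Ioi
  have h : ContinuousAt (fun r : ℝ => r ^ w) r := Real.continuousAt_rpow_const _ _ (Or.inl hr.ne')
  have h2 : ContinuousAt (fun r : ℝ => ((r ^ w : ℝ) : ℂ)) r :=
    Complex.continuous_ofReal.continuousAt.comp h
  exact (h2.mul (by fun_prop)).continuousWithinAt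

lemma integrableOn_powExp {w : ℝ} (hw : -1 < w) {ζ : ℂ} (hζ : 0 < ζ.re) :
    IntegrableOn (powExp w ζ) (Ioi 0) := by
  refine (integrableOn_rpow_mul_exp_neg_mul hw hζ).mono' (aestronglyMeasurable_powExp w ζ) ?_
  filter_upwards [ae_restrict_mem measurableSet_Ioi] with r hr
  exact (norm_powExp hr ζ).le

lemma hasDerivAt_integral_powExp {w : ℝ} (hw : -1 < w) {ζ : ℂ} (hζ : 0 < ζ.re) :
    HasDerivAt (fun ξ => ∫ r in Ioi (0 : ℝ), powExp w ξ r)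
      (-∫ r in Ioi (0 : ℝ), powExp (w + 1) ζ r) ζ := by
  rw [← integral_neg]
  have hs : {ξ : ℂ | ζ.re / 2 < ξ.re} ∈ 𝓝 ζ :=
    (isOpen_lt continuous_const Complex.continuous_re).mem_nhds (by simp; linarith)
  refine (hasDerivAt_integral_of_dominated_loc_of_deriv_le
    (bound := fun r => r ^ (w + 1) * Real.exp (-(ζ.re / 2) * r))
    (F' := fun ξ r => -powExp (w + 1) ξ r) hs
    (Eventually.of_forall fun ξ => aestronglyMeasurable_powExp w ξ) (integrableOn_powExp hw hζ)
    (aestronglyMeasurable_powExp _ ζ).neg ?_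
    (integrableOn_rpow_mul_exp_neg_mul (by linarith) (by linarith)) ?_).2
  · filter_upwards [ae_restrict_mem measurableSet_Ioi] with r hr ξ hξ
    rw [norm_neg, norm_powExp hr]
    have : 0 ≤ r ^ (w + 1) := Real.rpow_nonneg (le_of_lt hr) _
    have hr' : 0 < r := hr
    have hξ' : ζ.re / 2 < ξ.re := hξ
    gcongr
  · filter_upwards [ae_restrict_mem measurableSet_Ioi] with r hr ξ hξ
    have h1 : HasDerivAt (fun ξ : ℂ => -ξ * (r : ℂ)) (-1 * (r : ℂ)) ξ :=
      (hasDerivAt_id ξ).neg.mul_const _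
    have h2 := (h1.cexp).const_mul ((r ^ w : ℝ) : ℂ)
    refine h2.congr_deriv ?_
    rw [powExp, Real.rpow_add_one (ne_of_gt hr)]
    push_cast
    ring

lemma integral_powExp_add_one {w : ℝ} (hw : -1 < w) {ζ : ℂ} (hζ : 0 < ζ.re) :
    ζ * ∫ r in Ioi (0 : ℝ), powExp (w + 1) ζ r = (w + 1) * ∫ r in Ioi (0 : ℝ), powExp w ζ r := by
  have hd : ∀ r ∈ Ioi (0 : ℝ), HasDerivAt (powExp (w + 1) ζ)
      ((w + 1) * powExp w ζ r - ζ * powExp (w + 1) ζ r) r := by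
    intro r hr
    have h1 : HasDerivAt (fun r : ℝ => ((r ^ (w + 1) : ℝ) : ℂ)) (((w + 1) * r ^ w : ℝ) : ℂ) r := by
      have := Real.hasDerivAt_rpow_const (x := r) (p := w + 1) (Or.inl (ne_of_gt hr))
      rw [add_sub_cancel_right] at this
      exact this.ofReal_comp
    have h2 : HasDerivAt (fun r : ℝ => Complex.exp (-ζ * r)) (Complex.exp (-ζ * r) * (-ζ * 1)) r :=
      ((Complex.ofRealCLM.hasDerivAt (x := r)).const_mul (-ζ)).cexp
    refine (h1.mul h2).congr_deriv ?_
    simp only [powExp]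
    push_cast
    ring
  have hi := ((integrableOn_powExp hw hζ).const_mul ((w : ℂ) + 1)).sub
    ((integrableOn_powExp (w := w + 1) (by linarith) hζ).const_mul ζ)
  have hc : ContinuousWithinAt (powExp (w + 1) ζ) (Ici 0) 0 := by
    have h : ContinuousAt (fun r : ℝ => r ^ (w + 1)) 0 :=
      Real.continuousAt_rpow_const _ _ (Or.inr (by linarith))
    have h2 : ContinuousAt (fun r : ℝ => ((r ^ (w + 1) : ℝ) : ℂ)) 0 :=
      Complex.continuous_ofReal.continuousAt.comp h
    exact (h2.mul (by fun_prop)).continuousWithinAt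
  have hl : Tendsto (powExp (w + 1) ζ) atTop (𝓝 0) := by
    rw [tendsto_zero_iff_norm_tendsto_zero]
    have := tendsto_rpow_mul_exp_neg_mul_atTop_nhds_zero (w + 1) ζ.re hζ
    refine this.congr' ?_
    filter_upwards [eventually_gt_atTop 0] with r hr
    exact (norm_powExp hr ζ).symm
  have key := integral_Ioi_of_hasDerivAt_of_tendsto hc hd hi hl
  have e := integral_sub ((integrableOn_powExp hw hζ).const_mul ((w : ℂ) + 1))
    ((integrableOn_powExp (w := w + 1) (by linarith) hζ).const_mul ζ)
  have z : powExp (w + 1) ζ 0 = 0 := by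
    simp [powExp, Real.zero_rpow (show w + 1 ≠ 0 by linarith)]
  rw [e, integral_const_mul, integral_const_mul, z] at key
  linear_combination -key

lemma integral_powExp {w : ℝ} (hw : -1 < w) {ζ : ℂ} (hζ : 0 < ζ.re) :
    ζ ^ ((w + 1 : ℝ) : ℂ) * ∫ r in Ioi (0 : ℝ), powExp w ζ r = Real.Gamma (w + 1) := by
  set f : ℂ → ℂ := fun ξ => ξ ^ ((w + 1 : ℝ) : ℂ) * ∫ r in Ioi (0 : ℝ), powExp w ξ r with hf
  have hd : ∀ ξ ∈ {ξ : ℂ | 0 < ξ.re}, HasDerivAt f 0 ξ := by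
    intro ξ hξ
    have hξ' : 0 < ξ.re := hξ
    have hs : ξ ∈ Complex.slitPlane := Or.inl hξ'
    have h0 : ξ ≠ 0 := Complex.slitPlane_ne_zero hs
    have h1 := ((hasDerivAt_id ξ).cpow_const (c := ((w + 1 : ℝ) : ℂ)) hs).mul
      (hasDerivAt_integral_powExp hw hξ')
    refine h1.congr_deriv ?_
    have e := integral_powExp_add_one hw hξ'
    have p : (id ξ) ^ ((w + 1 : ℝ) : ℂ) = ξ ^ (((w + 1 : ℝ) : ℂ) - 1) * ξ := by
      rw [Complex.cpow_sub _ _ h0, Complex.cpow_one]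
      simp
      field_simp
    rw [p]
    simp only [id] at e ⊢
    push_cast
    linear_combination (-(ξ ^ ((w + 1 : ℂ) - 1))) * e
  have hc := (isOpen_lt continuous_const Complex.continuous_re).is_const_of_deriv_eq_zero
    (convex_halfSpace_re_gt 0).isPreconnected
    (fun ξ hξ => (hd ξ hξ).differentiableAt.differentiableWithinAt)
    (fun ξ hξ => (hd ξ hξ).deriv) (x := ζ) (y := 1) hζ (by simp)
  have h1 : f 1 = Real.Gamma (w + 1) := by
    simp only [hf, Complex.one_cpow, one_mul]
    rw [Real.Gamma_eq_integral (by linarith), ← integral_complex_ofReal]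
    refine setIntegral_congr_fun measurableSet_Ioi fun r _ => ?_
    simp [powExp, mul_comm]
  rw [← h1, ← hc]

/-- The ray from `a` in the direction `exp (θ I)`, the upper half of a Hankel contour. -/
noncomputable def ray (θ a r : ℝ) : ℂ := a + r * Complex.exp (θ * Complex.I)

lemma ray_re (θ a r : ℝ) : (ray θ a r).re = a + r * Real.cos θ := by
  simp [ray, Complex.exp_ofReal_mul_I_re, Complex.exp_ofReal_mul_I_im]

lemma ray_im (θ a r : ℝ) : (ray θ a r).im = r * Real.sin θ := by
  simp [ray, Complex.exp_ofReal_mul_I_re, Complex.exp_ofReal_mul_I_im]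

lemma norm_ray_le {θ a r : ℝ} (ha : 0 ≤ a) (hr : 0 ≤ r) : ‖ray θ a r‖ ≤ a + r := by
  refine (norm_add_le _ _).trans ?_
  simp [Complex.norm_exp_ofReal_mul_I, abs_of_nonneg ha, abs_of_nonneg hr]

lemma mul_sin_le_norm_ray (θ a r : ℝ) : a * Real.sin θ ≤ ‖ray θ a r‖ := by
  rw [Complex.norm_eq_sqrt_sq_add_sq, ray_re, ray_im]
  apply Real.le_sqrt_of_sq_le
  rw [mul_pow, mul_pow, Real.sin_sq]
  nlinarith [sq_nonneg (a * Real.cos θ + r)]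

lemma ray_mem_slitPlane {θ a r : ℝ} (hθ0 : 0 < θ) (hθ : θ < π) (hr : 0 ≤ r)
    (h : 0 < a + r) : ray θ a r ∈ Complex.slitPlane := by
  rcases hr.eq_or_lt with rfl | hr
  · left
    rw [ray_re]
    linarith
  · right
    rw [ray_im]
    exact (mul_pos hr (Real.sin_pos_of_pos_of_lt_pi hθ0 hθ)).ne'

lemma continuous_ray (θ a : ℝ) : Continuous (ray θ a) := by
  unfold ray
  fun_prop

lemma hasDerivAt_ray_left (θ a r : ℝ) : HasDerivAt (fun a => ray θ a r) 1 a := by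
  unfold ray
  exact (Complex.ofRealCLM.hasDerivAt (x := a)).add_const _

lemma hasDerivAt_ray_right (θ a r : ℝ) :
    HasDerivAt (ray θ a) (Complex.exp (θ * Complex.I)) r := by
  unfold ray
  simpa using ((Complex.ofRealCLM.hasDerivAt (x := r)).mul_const
    (Complex.exp (θ * Complex.I))).const_add (a : ℂ)

/-- The integrand `exp s * s ^ w` of the Hankel integral for `1 / Γ(-w)`, on a ray. -/
noncomputable def hankel (θ w a r : ℝ) : ℂ :=
  Complex.exp (ray θ a r) * ray θ a r ^ (w : ℂ)

lemma norm_hankel (θ w a r : ℝ) :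
    ‖hankel θ w a r‖ = Real.exp (a + r * Real.cos θ) * ‖ray θ a r‖ ^ w := by
  rw [hankel, norm_mul, Complex.norm_exp, ray_re, Complex.norm_cpow_real]

lemma hasDerivAt_expCpow {z : ℂ} (hz : z ∈ Complex.slitPlane) (w : ℝ) :
    HasDerivAt (fun z => Complex.exp z * z ^ (w : ℂ))
      (Complex.exp z * z ^ (w : ℂ) + w * (Complex.exp z * z ^ ((w - 1 : ℝ) : ℂ))) z := by
  refine ((Complex.hasDerivAt_exp z).mul ((hasDerivAt_id z).cpow_const hz)).congr_deriv ?_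
  simp
  ring

lemma aestronglyMeasurable_hankel {θ : ℝ} (hθ0 : 0 < θ) (hθ : θ < π) (w : ℝ) {a : ℝ}
    (ha : 0 ≤ a) : AEStronglyMeasurable (hankel θ w a) (volume.restrict (Ioi 0)) := by
  refine ContinuousOn.aestronglyMeasurable (fun r hr => ?_) measurableSet_Ioi
  have hr' : 0 < r := hr
  have hs := ray_mem_slitPlane (a := a) hθ0 hθ hr'.le (by linarith)
  exact (((hasDerivAt_expCpow hs w).comp r
    (hasDerivAt_ray_right θ a r)).continuousAt).continuousWithinAt

lemma exists_norm_hankel_le {θ : ℝ} (hθ : Real.cos θ < 0) (N : ℕ) {A K : ℝ} (hA : 0 ≤ A)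
    (hK : 0 ≤ K) : ∃ C : ℝ, ∀ a r w : ℝ, 0 ≤ a → a ≤ A → 0 ≤ r →
      ‖ray θ a r‖ ^ w ≤ K + ‖ray θ a r‖ ^ N →
      ‖hankel θ w a r‖ ≤ C * Real.exp (-(-Real.cos θ / 2) * r) := by
  set c := -Real.cos θ / 2 with hc
  have hc0 : 0 < c := by rw [hc]; linarith
  refine ⟨Real.exp A * (K + N.factorial / c ^ N * Real.exp (c * A)), fun a r w ha haA hr h => ?_⟩
  have h1 : ‖ray θ a r‖ ^ N ≤ N.factorial / c ^ N * Real.exp (c * A) * Real.exp (c * r) := by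
    have h2 : ‖ray θ a r‖ ^ N ≤ (A + r) ^ N :=
      pow_le_pow_left₀ (norm_nonneg _) ((norm_ray_le ha hr).trans (by linarith)) _
    have h3 := Real.pow_div_factorial_le_exp (c * (A + r)) (by positivity) N
    rw [mul_assoc, ← Real.exp_add, ← mul_add]
    refine h2.trans ?_
    rw [div_mul_eq_mul_div, le_div_iff₀ (by positivity)]
    rw [div_le_iff₀ (by positivity), mul_pow] at h3
    linarith
  rw [norm_hankel]
  have h4 : K ≤ K * Real.exp (c * r) :=
    le_mul_of_one_le_right hK (Real.one_le_exp (by positivity))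
  calc Real.exp (a + r * Real.cos θ) * ‖ray θ a r‖ ^ w
      ≤ Real.exp (A + r * Real.cos θ) * (K * Real.exp (c * r) +
        N.factorial / c ^ N * Real.exp (c * A) * Real.exp (c * r)) := by
        gcongr
        exact h.trans (add_le_add h4 h1)
    _ = Real.exp A * (K + N.factorial / c ^ N * Real.exp (c * A)) *
        (Real.exp (r * Real.cos θ) * Real.exp (c * r)) := by
        rw [Real.exp_add]; ring
    _ = _ := by
        rw [← Real.exp_add]
        congr 2
        rw [hc]; ring

lemma exists_norm_hankel_le_of_pos {θ : ℝ} (hθ : Real.cos θ < 0) (hs : 0 < Real.sin θ) (N : ℕ)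
    {a₀ A : ℝ} (ha₀ : 0 < a₀) (hA : 0 ≤ A) :
    ∃ C : ℝ, ∀ a r w : ℝ, a₀ ≤ a → a ≤ A → 0 ≤ r → |w| ≤ N →
      ‖hankel θ w a r‖ ≤ C * Real.exp (-(-Real.cos θ / 2) * r) := by
  obtain ⟨C, hC⟩ := exists_norm_hankel_le hθ N hA
    (K := (a₀ * Real.sin θ) ^ (-(N : ℝ))) (by positivity)
  refine ⟨C, fun a r w ha haA hr hw => hC a r w (by linarith) haA hr ?_⟩
  have hm : a₀ * Real.sin θ ≤ ‖ray θ a r‖ :=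
    (mul_le_mul_of_nonneg_right ha hs.le).trans (mul_sin_le_norm_ray θ a r)
  have hm0 : 0 < a₀ * Real.sin θ := by positivity
  have hx : 0 < ‖ray θ a r‖ := hm0.trans_le hm
  have hw' := abs_le.1 hw
  rcases le_total 1 ‖ray θ a r‖ with h1 | h1
  · have := Real.rpow_le_rpow_of_exponent_le h1 hw'.2
    rw [Real.rpow_natCast] at this
    have h2 : 0 ≤ (a₀ * Real.sin θ) ^ (-(N : ℝ)) := by positivity
    linarith
  · have := Real.rpow_le_rpow_of_exponent_ge hx h1 hw'.1
    have h2 : ‖ray θ a r‖ ^ (-(N : ℝ)) ≤ (a₀ * Real.sin θ) ^ (-(N : ℝ)) :=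
      Real.rpow_le_rpow_of_nonpos hm0 hm (by simp)
    have h3 : 0 ≤ ‖ray θ a r‖ ^ N := by positivity
    linarith

lemma exists_norm_hankel_le_of_nonneg {θ : ℝ} (hθ : Real.cos θ < 0) {w A : ℝ} (hw : 0 ≤ w)
    (hA : 0 ≤ A) : ∃ C : ℝ, ∀ a r : ℝ, 0 ≤ a → a ≤ A → 0 ≤ r →
      ‖hankel θ w a r‖ ≤ C * Real.exp (-(-Real.cos θ / 2) * r) := by
  obtain ⟨C, hC⟩ := exists_norm_hankel_le hθ ⌈w⌉₊ hA (K := 1) zero_le_one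
  refine ⟨C, fun a r ha haA hr => hC a r w ha haA hr ?_⟩
  rcases le_total 1 ‖ray θ a r‖ with h1 | h1
  · have := Real.rpow_le_rpow_of_exponent_le h1 (Nat.le_ceil w)
    rw [Real.rpow_natCast] at this
    linarith
  · have := Real.rpow_le_one (norm_nonneg _) h1 hw
    have h3 : 0 ≤ ‖ray θ a r‖ ^ ⌈w⌉₊ := by positivity
    linarith

lemma integrableOn_hankel_bound {θ : ℝ} (hθ : Real.cos θ < 0) (C : ℝ) :
    IntegrableOn (fun r => C * Real.exp (-(-Real.cos θ / 2) * r)) (Ioi 0) :=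
  (exp_neg_integrableOn_Ioi 0 (by linarith)).const_mul C

lemma cos_neg_of_obtuse {θ : ℝ} (hθ2 : π / 2 < θ) (hθ : θ < π) : Real.cos θ < 0 :=
  Real.cos_neg_of_pi_div_two_lt_of_lt hθ2 (by linarith [Real.pi_pos])

lemma sin_pos_of_obtuse {θ : ℝ} (hθ2 : π / 2 < θ) (hθ : θ < π) : 0 < Real.sin θ :=
  Real.sin_pos_of_pos_of_lt_pi (by linarith [Real.pi_pos]) hθ

lemma integrableOn_hankel {θ : ℝ} (hθ2 : π / 2 < θ) (hθ : θ < π) (w : ℝ) {a : ℝ} (ha : 0 < a) :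
    IntegrableOn (hankel θ w a) (Ioi 0) := by
  have hc := cos_neg_of_obtuse hθ2 hθ
  obtain ⟨C, hC⟩ := exists_norm_hankel_le_of_pos hc (sin_pos_of_obtuse hθ2 hθ) ⌈|w|⌉₊ ha ha.le
  refine (integrableOn_hankel_bound hc C).mono'
    (aestronglyMeasurable_hankel (by linarith [Real.pi_pos]) hθ w ha.le) ?_
  filter_upwards [ae_restrict_mem measurableSet_Ioi] with r hr
  exact hC a r w le_rfl le_rfl (le_of_lt hr) (Nat.le_ceil _)

lemma integral_hankel_by_parts {θ : ℝ} (hθ2 : π / 2 < θ) (hθ : θ < π) (w : ℝ) {a : ℝ}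
    (ha : 0 < a) :
    (Complex.exp (θ * Complex.I) *
      ∫ r in Ioi (0 : ℝ), (hankel θ w a r + w * hankel θ (w - 1) a r)).im = 0 := by
  have hc := cos_neg_of_obtuse hθ2 hθ
  have hθ0 : 0 < θ := by linarith [Real.pi_pos]
  have hd : ∀ r ∈ Ici (0 : ℝ), HasDerivAt (hankel θ w a)
      (Complex.exp (θ * Complex.I) * (hankel θ w a r + w * hankel θ (w - 1) a r)) r := by
    intro r hr
    have hr' : 0 ≤ r := hr
    have hs := ray_mem_slitPlane (a := a) hθ0 hθ hr' (by linarith)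
    refine ((hasDerivAt_expCpow hs w).comp r (hasDerivAt_ray_right θ a r)).congr_deriv ?_
    simp only [hankel]
    ring
  have hi := ((integrableOn_hankel hθ2 hθ w ha).add
    ((integrableOn_hankel hθ2 hθ (w - 1) ha).const_mul (w : ℂ))).const_mul
      (Complex.exp (θ * Complex.I))
  have hl : Tendsto (hankel θ w a) atTop (𝓝 0) := by
    obtain ⟨C, hC⟩ := exists_norm_hankel_le_of_pos hc (sin_pos_of_obtuse hθ2 hθ) ⌈|w|⌉₊ ha ha.le
    have h0 : Tendsto (fun r => C * Real.exp (-(-Real.cos θ / 2) * r)) atTop (𝓝 (C * 0)) := by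
      refine (Real.tendsto_exp_atBot.comp ?_).const_mul C
      exact tendsto_id.const_mul_atTop_of_neg (by linarith)
    rw [mul_zero] at h0
    refine squeeze_zero_norm' ?_ h0
    filter_upwards [eventually_ge_atTop 0] with r hr
    exact hC a r w le_rfl le_rfl hr (Nat.le_ceil _)
  have key := integral_Ioi_of_hasDerivAt_of_tendsto' hd hi hl
  rw [← integral_const_mul, key]
  have : hankel θ w a 0 = ((Real.exp a * a ^ w : ℝ) : ℂ) := by
    simp [hankel, ray, Complex.ofReal_cpow ha.le]
  rw [this, zero_sub, Complex.neg_im, Complex.ofReal_im, neg_zero]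

lemma hasDerivAt_integral_hankel {θ : ℝ} (hθ2 : π / 2 < θ) (hθ : θ < π) (w : ℝ) {a : ℝ}
    (ha : 0 < a) :
    HasDerivAt (fun a => ∫ r in Ioi (0 : ℝ), hankel θ w a r)
      (∫ r in Ioi (0 : ℝ), (hankel θ w a r + w * hankel θ (w - 1) a r)) a := by
  have hc := cos_neg_of_obtuse hθ2 hθ
  have hθ0 : 0 < θ := by linarith [Real.pi_pos]
  obtain ⟨C, hC⟩ := exists_norm_hankel_le_of_pos hc (sin_pos_of_obtuse hθ2 hθ) (⌈|w|⌉₊ + 1)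
    (half_pos ha) (A := 2 * a) (by linarith)
  have hw : |w| ≤ ((⌈|w|⌉₊ + 1 : ℕ) : ℝ) := by push_cast; linarith [Nat.le_ceil |w|]
  have hw1 : |w - 1| ≤ ((⌈|w|⌉₊ + 1 : ℕ) : ℝ) := by
    push_cast
    have := abs_sub w 1
    rw [abs_one] at this
    linarith [Nat.le_ceil |w|]
  refine (hasDerivAt_integral_of_dominated_loc_of_deriv_le
    (F' := fun a r => hankel θ w a r + w * hankel θ (w - 1) a r)
    (bound := fun r => C * Real.exp (-(-Real.cos θ / 2) * r) +
      |w| * (C * Real.exp (-(-Real.cos θ / 2) * r)))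
    (Ioo_mem_nhds (show a / 2 < a by linarith) (show a < 2 * a by linarith)) ?_
    (integrableOn_hankel hθ2 hθ w ha) ?_ ?_ ?_ ?_).2
  · filter_upwards [eventually_gt_nhds ha] with b hb
    exact aestronglyMeasurable_hankel hθ0 hθ w hb.le
  · exact (aestronglyMeasurable_hankel hθ0 hθ w ha.le).add
      ((aestronglyMeasurable_hankel hθ0 hθ (w - 1) ha.le).const_mul _)
  · filter_upwards [ae_restrict_mem measurableSet_Ioi] with r hr b hb
    refine (norm_add_le _ _).trans (add_le_add (hC b r w hb.1.le hb.2.le (le_of_lt hr) hw) ?_)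
    rw [norm_mul, Complex.norm_real, Real.norm_eq_abs]
    exact mul_le_mul_of_nonneg_left (hC b r _ hb.1.le hb.2.le (le_of_lt hr) hw1) (abs_nonneg _)
  · exact (integrableOn_hankel_bound hc C).add ((integrableOn_hankel_bound hc C).const_mul _)
  · filter_upwards [ae_restrict_mem measurableSet_Ioi] with r hr b hb
    have hr' : 0 < r := hr
    have hs := ray_mem_slitPlane (a := b) hθ0 hθ hr'.le (by linarith [hb.1])
    refine ((hasDerivAt_expCpow hs w).comp b (hasDerivAt_ray_left θ b r)).congr_deriv ?_
    simp only [hankel]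
    ring

/-- The imaginary part of the Hankel integral along a ray. -/
noncomputable def hankelIm (θ w a : ℝ) : ℝ :=
  (Complex.exp (θ * Complex.I) * ∫ r in Ioi (0 : ℝ), hankel θ w a r).im

lemma hankelIm_add_mul {θ : ℝ} (hθ2 : π / 2 < θ) (hθ : θ < π) (w : ℝ) {a : ℝ} (ha : 0 < a) :
    hankelIm θ w a + w * hankelIm θ (w - 1) a = 0 := by
  rw [← integral_hankel_by_parts hθ2 hθ w ha, integral_add (integrableOn_hankel hθ2 hθ w ha)
    ((integrableOn_hankel hθ2 hθ (w - 1) ha).const_mul (w : ℂ)), integral_const_mul, mul_add,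
    Complex.add_im, mul_left_comm, Complex.im_ofReal_mul]
  rfl

lemma hankelIm_eq {θ : ℝ} (hθ2 : π / 2 < θ) (hθ : θ < π) (w : ℝ) {a b : ℝ} (ha : 0 < a)
    (hb : 0 < b) : hankelIm θ w a = hankelIm θ w b := by
  have hd : ∀ a ∈ Ioi (0 : ℝ), HasDerivAt (hankelIm θ w) 0 a := by
    intro a ha
    have h := (hasDerivAt_integral_hankel hθ2 hθ w ha).const_mul (Complex.exp (θ * Complex.I))
    have h2 := Complex.imCLM.hasFDerivAt.comp_hasDerivAt a h
    exact h2.congr_deriv (integral_hankel_by_parts hθ2 hθ w ha)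
  exact isOpen_Ioi.is_const_of_deriv_eq_zero isPreconnected_Ioi
    (fun ξ hξ => (hd ξ hξ).differentiableAt.differentiableWithinAt)
    (fun ξ hξ => (hd ξ hξ).deriv) ha hb

lemma hankelIm_eq_zero_start {θ : ℝ} (hθ2 : π / 2 < θ) (hθ : θ < π) {w : ℝ} (hw : 0 ≤ w) {a : ℝ}
    (ha : 0 < a) : hankelIm θ w a = hankelIm θ w 0 := by
  have hc := cos_neg_of_obtuse hθ2 hθ
  have hθ0 : 0 < θ := by linarith [Real.pi_pos]
  obtain ⟨C, hC⟩ := exists_norm_hankel_le_of_nonneg hc hw (A := 1) zero_le_one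
  have ht : Tendsto (fun a => ∫ r in Ioi (0 : ℝ), hankel θ w a r) (𝓝[>] 0)
      (𝓝 (∫ r in Ioi (0 : ℝ), hankel θ w 0 r)) := by
    refine tendsto_integral_filter_of_dominated_convergence
      (fun r => C * Real.exp (-(-Real.cos θ / 2) * r)) ?_ ?_ (integrableOn_hankel_bound hc C) ?_
    · filter_upwards [self_mem_nhdsWithin] with b hb
      exact aestronglyMeasurable_hankel hθ0 hθ w (le_of_lt hb)
    · filter_upwards [Ioc_mem_nhdsGT zero_lt_one] with b hb
      filter_upwards [ae_restrict_mem measurableSet_Ioi] with r hr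
      exact hC b r hb.1.le hb.2 (le_of_lt hr)
    · filter_upwards [ae_restrict_mem measurableSet_Ioi] with r hr
      have hr' : 0 < r := hr
      have hs := ray_mem_slitPlane (a := 0) hθ0 hθ hr'.le (by linarith)
      have : ContinuousAt (fun a => hankel θ w a r) 0 :=
        ((hasDerivAt_expCpow hs w).comp (h₂ := fun z => Complex.exp z * z ^ (w : ℂ)) (0 : ℝ)
          (hasDerivAt_ray_left θ 0 r)).continuousAt
      exact this.tendsto.mono_left nhdsWithin_le_nhds
  have ht2 : Tendsto (hankelIm θ w) (𝓝[>] 0) (𝓝 (hankelIm θ w 0)) :=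
    (Complex.continuous_im.tendsto _).comp (ht.const_mul _)
  refine tendsto_nhds_unique (Tendsto.congr' ?_ tendsto_const_nhds) ht2
  filter_upwards [self_mem_nhdsWithin] with b hb
  exact hankelIm_eq hθ2 hθ w ha hb

lemma ofReal_mul_exp_mul_I_cpow {r φ : ℝ} (hr : 0 < r) (hφ : -π < φ) (hφ' : φ ≤ π) (w : ℝ) :
    ((r : ℂ) * Complex.exp (φ * Complex.I)) ^ (w : ℂ) =
      ((r ^ w : ℝ) : ℂ) * Complex.exp ((φ * w : ℝ) * Complex.I) := by
  have hr0 : (r : ℂ) ≠ 0 := Complex.ofReal_ne_zero.2 hr.ne'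
  rw [Complex.cpow_def_of_ne_zero (mul_ne_zero hr0 (Complex.exp_ne_zero _)),
    Complex.log_ofReal_mul hr (Complex.exp_ne_zero _),
    Complex.log_exp (by simpa using hφ) (by simpa using hφ'), Real.rpow_def_of_pos hr,
    Complex.ofReal_exp, ← Complex.exp_add]
  congr 1
  push_cast
  ring

lemma hankelIm_zero_right {θ : ℝ} (hθ2 : π / 2 < θ) (hθ : θ < π) {w : ℝ} (hw : 0 ≤ w) :
    hankelIm θ w 0 = π * (Real.Gamma (-w))⁻¹ := by
  have hc := cos_neg_of_obtuse hθ2 hθ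
  have hθ0 : 0 < θ := by linarith [Real.pi_pos]
  set ζ : ℂ := -Complex.exp (θ * Complex.I) with hζ
  have hζre : 0 < ζ.re := by
    rw [hζ, Complex.neg_re, Complex.exp_ofReal_mul_I_re]; linarith
  have hI : Complex.exp (θ * Complex.I) * ∫ r in Ioi (0 : ℝ), hankel θ w 0 r =
      Complex.exp ((θ * (w + 1) : ℝ) * Complex.I) * ∫ r in Ioi (0 : ℝ), powExp w ζ r := by
    rw [← integral_const_mul, ← integral_const_mul]
    refine setIntegral_congr_fun measurableSet_Ioi fun r hr => ?_
    have hr' : 0 < r := hr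
    simp only [hankel, powExp, ray, Complex.ofReal_zero, zero_add]
    rw [ofReal_mul_exp_mul_I_cpow hr' (by linarith) hθ.le, show -ζ * (r : ℂ) =
      r * Complex.exp (θ * Complex.I) by rw [hζ]; ring, mul_add, mul_one, Complex.ofReal_add,
      add_mul, Complex.exp_add]
    ring
  have hζ' : ζ = ((1 : ℝ) : ℂ) * Complex.exp ((θ - π : ℝ) * Complex.I) := by
    push_cast
    rw [sub_mul, Complex.exp_sub, Complex.exp_pi_mul_I, hζ]
    ring
  have hG := integral_powExp (w := w) (by linarith) hζre
  have hp := ofReal_mul_exp_mul_I_cpow one_pos (show -π < θ - π by linarith)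
    (show θ - π ≤ π by linarith) (w + 1)
  rw [← hζ', Real.one_rpow, Complex.ofReal_one, one_mul] at hp
  have hE : Complex.exp ((θ * (w + 1) : ℝ) * Complex.I) =
      Complex.exp ((π * (w + 1) : ℝ) * Complex.I) *
        Complex.exp (((θ - π) * (w + 1) : ℝ) * Complex.I) := by
    rw [← Complex.exp_add]
    congr 1
    push_cast
    ring
  rw [hankelIm, hI, hE, mul_assoc, ← hp, hG, mul_comm, Complex.im_ofReal_mul,
    Complex.exp_ofReal_mul_I_im]
  have hr := Real.Gamma_mul_Gamma_one_sub (w + 1)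
  rw [show 1 - (w + 1) = -w by ring] at hr
  have hg : Real.Gamma (w + 1) ≠ 0 := (Real.Gamma_pos_of_pos (by linarith)).ne'
  by_cases hs : Real.sin (π * (w + 1)) = 0
  · rw [hs, div_zero, mul_eq_zero, or_iff_right hg] at hr
    rw [hs, hr]
    simp
  · have hg2 : Real.Gamma (-w) ≠ 0 := by
      intro h
      rw [h, mul_zero, eq_comm, div_eq_zero_iff] at hr
      exact hr.elim Real.pi_ne_zero hs
    rw [eq_div_iff hs] at hr
    rw [eq_mul_inv_iff_mul_eq₀ hg2]
    linarith

lemma hankelIm_of_nonneg {θ : ℝ} (hθ2 : π / 2 < θ) (hθ : θ < π) {w : ℝ} (hw : 0 ≤ w) {a : ℝ}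
    (ha : 0 < a) : hankelIm θ w a = π * (Real.Gamma (-w))⁻¹ := by
  rw [hankelIm_eq_zero_start hθ2 hθ hw ha, hankelIm_zero_right hθ2 hθ hw]

lemma hankelIm_sub_one {θ : ℝ} (hθ2 : π / 2 < θ) (hθ : θ < π) {w : ℝ} (hw : w ≠ 0) {a : ℝ}
    (ha : 0 < a) (h : hankelIm θ w a = π * (Real.Gamma (-w))⁻¹) :
    hankelIm θ (w - 1) a = π * (Real.Gamma (-(w - 1)))⁻¹ := by
  have h1 := hankelIm_add_mul hθ2 hθ w ha
  have h2 := Real.Gamma_add_one (neg_ne_zero.2 hw)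
  rw [show -(w - 1) = -w + 1 by ring, h2, mul_inv]
  rw [h] at h1
  refine mul_left_cancel₀ hw ?_
  rw [inv_neg]
  field_simp at h1 ⊢
  linarith

lemma continuousAt_hankelIm {θ : ℝ} (hθ2 : π / 2 < θ) (hθ : θ < π) (w : ℝ) {a : ℝ}
    (ha : 0 < a) : ContinuousAt (fun w => hankelIm θ w a) w := by
  have hc := cos_neg_of_obtuse hθ2 hθ
  have hθ0 : 0 < θ := by linarith [Real.pi_pos]
  obtain ⟨C, hC⟩ := exists_norm_hankel_le_of_pos hc (sin_pos_of_obtuse hθ2 hθ) (⌈|w|⌉₊ + 1)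
    ha ha.le
  have h : ContinuousAt (fun w => ∫ r in Ioi (0 : ℝ), hankel θ w a r) w := by
    refine tendsto_integral_filter_of_dominated_convergence
      (fun r => C * Real.exp (-(-Real.cos θ / 2) * r)) ?_ ?_ (integrableOn_hankel_bound hc C) ?_
    · exact Eventually.of_forall fun v => aestronglyMeasurable_hankel hθ0 hθ v ha.le
    · filter_upwards [Ioo_mem_nhds (show w - 1 < w by linarith) (show w < w + 1 by linarith)]
        with v hv
      filter_upwards [ae_restrict_mem measurableSet_Ioi] with r hr
      refine hC a r v le_rfl le_rfl (le_of_lt hr) ?_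
      push_cast
      have h1 := Nat.le_ceil |w|
      have h2 := abs_le.1 h1
      exact abs_le.2 ⟨by linarith [hv.1], by linarith [hv.2]⟩
    · filter_upwards [ae_restrict_mem measurableSet_Ioi] with r hr
      have hr' : 0 < r := hr
      have hs := ray_mem_slitPlane (a := a) hθ0 hθ hr'.le (by linarith)
      have h0 := Complex.slitPlane_ne_zero hs
      have : Continuous (fun w : ℝ => hankel θ w a r) :=
        continuous_const.mul (Complex.continuous_ofReal.const_cpow (Or.inl h0))
      exact this.tendsto w
  exact Complex.continuous_im.continuousAt.comp (h.const_mul (Complex.exp (θ * Complex.I)))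

/-- Hankel's formula for the reciprocal Gamma function at real arguments. -/
theorem hankelIm_eq_inv_Gamma {θ : ℝ} (hθ2 : π / 2 < θ) (hθ : θ < π) (w : ℝ) {a : ℝ}
    (ha : 0 < a) : hankelIm θ w a = π * (Real.Gamma (-w))⁻¹ := by
  have h1 : ∀ w : ℝ, -1 < w → hankelIm θ w a = π * (Real.Gamma (-w))⁻¹ := by
    intro w hw
    rcases le_or_gt 0 w with h | h
    · exact hankelIm_of_nonneg hθ2 hθ h ha
    · have := hankelIm_sub_one hθ2 hθ (w := w + 1) (by linarith) ha
        (hankelIm_of_nonneg hθ2 hθ (by linarith) ha)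
      rwa [add_sub_cancel_right] at this
  have h2 : hankelIm θ (-1) a = π * (Real.Gamma (-(-1)))⁻¹ := by
    have hG : ContinuousAt (fun w : ℝ => π * (Real.Gamma (-w))⁻¹) (-1) := by
      have hd : ContinuousAt Real.Gamma (-(-1)) := by
        refine (Real.differentiableAt_Gamma fun m => ?_).continuousAt
        have : (0 : ℝ) ≤ m := m.cast_nonneg
        linarith
      have hd' : ContinuousAt (fun w : ℝ => Real.Gamma (-w)) (-1) :=
        ContinuousAt.comp (f := fun w : ℝ => -w) hd continuous_neg.continuousAt
      exact continuousAt_const.mul (hd'.inv₀ (by simp))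
    have l1 := (continuousAt_hankelIm hθ2 hθ (-1) ha).tendsto.mono_left
      (nhdsWithin_le_nhds (s := Ioi (-1)))
    have l2 := hG.tendsto.mono_left (nhdsWithin_le_nhds (s := Ioi (-1)))
    refine tendsto_nhds_unique (l1.congr' ?_) l2
    filter_upwards [self_mem_nhdsWithin] with v hv
    exact h1 v hv
  have h3 : ∀ n : ℕ, ∀ w : ℝ, -1 - (n : ℝ) ≤ w → hankelIm θ w a = π * (Real.Gamma (-w))⁻¹ := by
    intro n
    induction n with
    | zero =>
      intro w hw
      rcases hw.eq_or_lt with h | h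
      · rw [← h]; simpa using h2
      · exact h1 w (by simpa using h)
    | succ n ih =>
      intro w hw
      push_cast at hw
      rcases le_or_gt (-1) w with h | h
      · exact ih w (by have : (0 : ℝ) ≤ n := n.cast_nonneg
                       linarith)
      · have := hankelIm_sub_one hθ2 hθ (w := w + 1) (by linarith) ha (ih _ (by linarith))
        rwa [add_sub_cancel_right] at this
  exact h3 ⌈|w|⌉₊ w (by linarith [Nat.le_ceil |w|, neg_abs_le w])

lemma exists_mul_rpow_le {β X ε : ℝ} (hβ0 : 0 < β) (hβ1 : β < 1) (hX : 0 ≤ X) (hε : 0 < ε) :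
    ∃ D : ℝ, ∀ y : ℝ, 0 ≤ y → X * y ^ β ≤ D + ε * y := by
  set Y := (X / ε) ^ (1 / (1 - β)) with hY
  have hY0 : 0 ≤ Y := by positivity
  refine ⟨X * Y ^ β, fun y hy => ?_⟩
  rcases le_or_gt y Y with h | h
  · have : X * y ^ β ≤ X * Y ^ β := by gcongr
    nlinarith
  · have hy0 : 0 < y := hY0.trans_lt h
    have h1 : X / ε ≤ y ^ (1 - β) := by
      have h2 : Y ^ (1 - β) = X / ε := by
        rw [hY, ← Real.rpow_mul (by positivity), one_div_mul_cancel (by linarith), Real.rpow_one]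
      rw [← h2]
      exact Real.rpow_le_rpow hY0 h.le (by linarith)
    rw [div_le_iff₀ hε] at h1
    have h3 : y ^ (1 - β) * y ^ β = y := by
      rw [← Real.rpow_add hy0]; simp
    have h4 : 0 ≤ y ^ β := by positivity
    have h5 : 0 ≤ X * Y ^ β := by positivity
    nlinarith [mul_le_mul_of_nonneg_right h1 h4]

lemma hankel_add_mul {θ a r : ℝ} (h : ray θ a r ≠ 0) (v w : ℝ) (k : ℕ) :
    hankel θ (v + k * w) a r = hankel θ v a r * (ray θ a r ^ (w : ℂ)) ^ k := by
  rw [hankel, hankel, Complex.ofReal_add, Complex.cpow_add _ _ h, Complex.ofReal_mul,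
    Complex.ofReal_natCast, Complex.cpow_nat_mul, mul_assoc]

lemma arg_ray_le {θ : ℝ} (hθ2 : π / 2 < θ) (hθ : θ < π) {a r : ℝ} (ha : 0 < a) (hr : 0 ≤ r) :
    Complex.arg (ray θ a r) ≤ θ := by
  have hs := ray_mem_slitPlane (a := a) (by linarith [Real.pi_pos]) hθ hr (by linarith)
  have h0 := norm_pos_iff.2 (Complex.slitPlane_ne_zero hs)
  by_contra! h
  have h1 := Complex.norm_mul_cos_arg (ray θ a r)
  have h2 := Complex.norm_mul_sin_arg (ray θ a r)
  have h3 : 0 < Real.sin (Complex.arg (ray θ a r) - θ) :=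
    Real.sin_pos_of_pos_of_lt_pi (by linarith)
      (by linarith [Complex.arg_le_pi (ray θ a r), Real.pi_pos])
  have h4 : ‖ray θ a r‖ * Real.sin (Complex.arg (ray θ a r) - θ) = -(a * Real.sin θ) := by
    rw [Real.sin_sub, mul_sub, ← mul_assoc, ← mul_assoc, h1, h2, ray_re, ray_im]
    ring
  have h5 := mul_pos h0 h3
  have h6 := mul_pos ha (sin_pos_of_obtuse hθ2 hθ)
  linarith

lemma re_ray_cpow_nonneg {θ : ℝ} (hθ2 : π / 2 < θ) (hθ : θ < π) {β : ℝ} (hβ : 0 < β)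
    (hβθ : θ * β ≤ π / 2) {a r : ℝ} (ha : 0 < a) (hr : 0 ≤ r) :
    0 ≤ (ray θ a r ^ (β : ℂ)).re := by
  have hs := ray_mem_slitPlane (a := a) (by linarith [Real.pi_pos]) hθ hr (by linarith)
  have h0 := norm_pos_iff.2 (Complex.slitPlane_ne_zero hs)
  have h1 := arg_ray_le hθ2 hθ ha hr
  have h2 : 0 ≤ Complex.arg (ray θ a r) := by
    rw [Complex.arg_nonneg_iff, ray_im]
    exact mul_nonneg hr (sin_pos_of_obtuse hθ2 hθ).le
  rw [← Complex.norm_mul_exp_arg_mul_I (ray θ a r), ofReal_mul_exp_mul_I_cpow h0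
    (by linarith [Real.pi_pos]) (by linarith), Complex.re_ofReal_mul,
    Complex.exp_ofReal_mul_I_re]
  refine mul_nonneg (by positivity) (Real.cos_nonneg_of_neg_pi_div_two_le_of_le ?_ ?_)
  · nlinarith [Real.pi_pos]
  · nlinarith

lemma measurable_hankel (θ w a : ℝ) : Measurable (hankel θ w a) := by
  have := (continuous_ray θ a).measurable
  unfold hankel
  fun_prop

lemma hasSum_integral_hankel_wright {θ : ℝ} (hθ2 : π / 2 < θ) (hθ : θ < π) {β : ℝ} (hβ0 : 0 < β)
    (hβ1 : β < 1) {a : ℝ} (ha : 0 < a) (x : ℝ) :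
    HasSum (fun k : ℕ => ∫ r in Ioi (0 : ℝ),
        (((-x) ^ k / k.factorial : ℝ) : ℂ) * hankel θ ((β - 1) + k * β) a r)
      (∫ r in Ioi (0 : ℝ), hankel θ (β - 1) a r * Complex.exp (-x * ray θ a r ^ (β : ℂ))) := by
  have hc := cos_neg_of_obtuse hθ2 hθ
  have hθ0 : 0 < θ := by linarith [Real.pi_pos]
  have hm := (continuous_ray θ a).measurable
  have hb : ∀ r : ℝ, HasSum (fun k : ℕ => ‖hankel θ (β - 1) a r‖ *
      ((|x| * ‖ray θ a r‖ ^ β) ^ k / k.factorial))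
      (‖hankel θ (β - 1) a r‖ * Real.exp (|x| * ‖ray θ a r‖ ^ β)) := by
    intro r
    refine HasSum.mul_left _ ?_
    rw [Real.exp_eq_exp_ℝ]
    exact NormedSpace.expSeries_div_hasSum_exp _
  refine hasSum_integral_of_dominated_convergence (fun k r => ‖hankel θ (β - 1) a r‖ *
      ((|x| * ‖ray θ a r‖ ^ β) ^ k / k.factorial)) ?_ ?_ ?_ ?_ ?_
  · exact fun k => ((measurable_hankel θ _ a).const_mul _).aestronglyMeasurable
  · intro k
    filter_upwards [ae_restrict_mem measurableSet_Ioi] with r hr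
    have hs := ray_mem_slitPlane (a := a) hθ0 hθ (le_of_lt hr) (by linarith [mem_Ioi.1 hr])
    rw [hankel_add_mul (Complex.slitPlane_ne_zero hs), norm_mul, norm_mul, norm_pow,
      Complex.norm_cpow_real, Complex.norm_real, norm_div, norm_pow, norm_neg, Real.norm_eq_abs,
      Real.norm_natCast, mul_pow]
    apply le_of_eq
    ring
  · exact ae_of_all _ fun r => (hb r).summable
  · simp_rw [fun r => (hb r).tsum_eq]
    obtain ⟨D, hD⟩ := exists_mul_rpow_le hβ0 hβ1 (abs_nonneg x)
      (show 0 < -Real.cos θ / 4 by linarith)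
    obtain ⟨C, hC⟩ := exists_norm_hankel_le_of_pos hc (sin_pos_of_obtuse hθ2 hθ)
      ⌈|β - 1|⌉₊ ha ha.le
    refine Integrable.mono' (g := fun r => C * Real.exp (D + -Real.cos θ / 4 * a) *
        Real.exp (-(-Real.cos θ / 4) * r))
      ((exp_neg_integrableOn_Ioi 0 (by linarith)).const_mul _) ?_ ?_
    · have := measurable_hankel θ (β - 1) a
      exact Measurable.aestronglyMeasurable (by fun_prop)
    · filter_upwards [ae_restrict_mem measurableSet_Ioi] with r hr
      have h1 := hC a r (β - 1) le_rfl le_rfl (le_of_lt hr) (Nat.le_ceil _)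
      have h2 := hD _ (norm_nonneg (ray θ a r))
      have h3 := norm_ray_le (θ := θ) ha.le (le_of_lt hr)
      have h4 : |x| * ‖ray θ a r‖ ^ β ≤ D + -Real.cos θ / 4 * (a + r) :=
        h2.trans (by gcongr; linarith)
      rw [Real.norm_of_nonneg (by positivity)]
      calc _ ≤ C * Real.exp (-(-Real.cos θ / 2) * r) *
            Real.exp (D + -Real.cos θ / 4 * (a + r)) :=
            mul_le_mul h1 (Real.exp_le_exp.2 h4) (Real.exp_pos _).le ((norm_nonneg _).trans h1)
        _ = _ := by
            rw [mul_assoc, mul_assoc, ← Real.exp_add, ← Real.exp_add]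
            congr 2
            ring
  · filter_upwards [ae_restrict_mem measurableSet_Ioi] with r hr
    have hs := ray_mem_slitPlane (a := a) hθ0 hθ (le_of_lt hr) (by linarith [mem_Ioi.1 hr])
    have h1 : HasSum (fun k : ℕ => (-x * ray θ a r ^ (β : ℂ)) ^ k / (k.factorial : ℂ))
        (Complex.exp (-x * ray θ a r ^ (β : ℂ))) := by
      rw [Complex.exp_eq_exp_ℂ]
      exact NormedSpace.expSeries_div_hasSum_exp _
    refine (h1.mul_left (hankel θ (β - 1) a r)).congr_fun fun k => ?_
    rw [hankel_add_mul (Complex.slitPlane_ne_zero hs), mul_pow]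
    push_cast
    ring

lemma hasSum_wright {θ : ℝ} (hθ2 : π / 2 < θ) (hθ : θ < π) {β : ℝ} (hβ0 : 0 < β)
    (hβ1 : β < 1) {a : ℝ} (ha : 0 < a) (x : ℝ) :
    HasSum (fun k : ℕ => (-x) ^ k / ((k.factorial : ℝ) * Real.Gamma (1 - β * (k + 1))))
      (π⁻¹ * (Complex.exp (θ * Complex.I) * ∫ r in Ioi (0 : ℝ),
        hankel θ (β - 1) a r * Complex.exp (-x * ray θ a r ^ (β : ℂ))).im) := by
  have h := hasSum_integral_hankel_wright hθ2 hθ hβ0 hβ1 ha x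
  have h2 := ((Complex.hasSum_im (h.mul_left (Complex.exp (θ * Complex.I)))).mul_left π⁻¹)
  refine h2.congr_fun fun k => ?_
  rw [integral_const_mul, mul_left_comm, Complex.im_ofReal_mul]
  have e := hankelIm_eq_inv_Gamma hθ2 hθ ((β - 1) + k * β) ha
  rw [hankelIm, show -((β - 1) + k * β) = 1 - β * (k + 1) by ring] at e
  rw [e]
  field_simp

lemma integral_exp_mul_wright {θ : ℝ} (hθ2 : π / 2 < θ) (hθ : θ < π) {β : ℝ} (hβ : 0 < β)
    (hβθ : θ * β ≤ π / 2) {a : ℝ} (ha : 0 < a) {l : ℝ} (hl : 0 < l) :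
    ∫ x in Ioi (0 : ℝ), Real.exp (-l * x) *
      (π⁻¹ * (Complex.exp (θ * Complex.I) * ∫ r in Ioi (0 : ℝ),
        hankel θ (β - 1) a r * Complex.exp (-x * ray θ a r ^ (β : ℂ))).im) =
    π⁻¹ * (Complex.exp (θ * Complex.I) * ∫ r in Ioi (0 : ℝ),
        hankel θ (β - 1) a r * (l + ray θ a r ^ (β : ℂ))⁻¹).im := by
  set f : ℝ → ℝ → ℂ := fun x r => Complex.exp (-l * x) *
    (hankel θ (β - 1) a r * Complex.exp (-x * ray θ a r ^ (β : ℂ))) with hf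
  have hm := (continuous_ray θ a).measurable
  have hmh := measurable_hankel θ (β - 1) a
  have hfi : Integrable (Function.uncurry f)
      ((volume.restrict (Ioi (0 : ℝ))).prod (volume.restrict (Ioi (0 : ℝ)))) := by
    refine Integrable.mono' (Integrable.mul_prod (exp_neg_integrableOn_Ioi 0 hl)
      (integrableOn_hankel hθ2 hθ (β - 1) ha).norm) ?_ ?_
    · apply Measurable.aestronglyMeasurable
      simp only [hf, Function.uncurry_def]
      fun_prop
    · rw [Measure.prod_restrict]
      have hS : MeasurableSet (Ioi (0 : ℝ) ×ˢ Ioi (0 : ℝ)) :=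
        MeasurableSet.prod measurableSet_Ioi measurableSet_Ioi
      filter_upwards [ae_restrict_mem hS] with p hp
      obtain ⟨hp1, hp2⟩ := hp
      have h1 := re_ray_cpow_nonneg hθ2 hθ hβ hβθ ha (le_of_lt hp2)
      have h2 : ‖Complex.exp (-p.1 * ray θ a p.2 ^ (β : ℂ))‖ ≤ 1 := by
        rw [Complex.norm_exp, Real.exp_le_one_iff, ← Complex.ofReal_neg, Complex.re_ofReal_mul]
        have := mul_nonneg (le_of_lt hp1) h1
        linarith
      simp only [hf, Function.uncurry_def, norm_mul]
      have h3 : ‖Complex.exp (-l * p.1)‖ = Real.exp (-l * p.1) := by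
        rw [Complex.norm_exp]; simp
      rw [h3]
      gcongr
      exact mul_le_of_le_one_right (norm_nonneg _) h2
  have hx : ∀ x : ℝ, Real.exp (-l * x) * (π⁻¹ * (Complex.exp (θ * Complex.I) *
      ∫ r in Ioi (0 : ℝ), hankel θ (β - 1) a r *
        Complex.exp (-x * ray θ a r ^ (β : ℂ))).im) =
      π⁻¹ * (Complex.exp (θ * Complex.I) * ∫ r in Ioi (0 : ℝ), f x r).im := by
    intro x
    rw [hf, integral_const_mul, mul_left_comm (Complex.exp (θ * Complex.I)),
      show Complex.exp (-l * x) = ((Real.exp (-l * x) : ℝ) : ℂ) by push_cast; rfl,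
      Complex.im_ofReal_mul]
    ring
  simp_rw [hx]
  have hin := (hfi.integral_prod_left).const_mul (Complex.exp (θ * Complex.I))
  have him := integral_im hin
  simp only [RCLike.im_to_complex, Function.uncurry_apply_pair] at him
  rw [integral_const_mul, him, integral_const_mul, integral_integral_swap hfi]
  congr 3
  refine setIntegral_congr_fun measurableSet_Ioi fun r hr => ?_
  have h1 := re_ray_cpow_nonneg hθ2 hθ hβ hβθ ha (le_of_lt hr)
  have h2 : ∀ x : ℝ, f x r =
      hankel θ (β - 1) a r * Complex.exp (-(l + ray θ a r ^ (β : ℂ)) * x) := by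
    intro x
    rw [hf]
    simp only
    rw [mul_left_comm, ← Complex.exp_add]
    congr 2
    ring
  simp only [h2]
  rw [integral_const_mul, integral_exp_mul_complex_Ioi (by simp; linarith)]
  rw [Complex.ofReal_zero, mul_zero, Complex.exp_zero, neg_div_neg_eq, one_div]

lemma hasSum_integral_hankel_resolvent {θ : ℝ} (hθ2 : π / 2 < θ) (hθ : θ < π) {β : ℝ}
    (hβ : 0 < β) {a : ℝ} (ha : 0 < a) {l : ℝ} (hl : 0 < l)
    (hal : 2 * l ≤ (a * Real.sin θ) ^ β) :
    HasSum (fun k : ℕ => ∫ r in Ioi (0 : ℝ), (((-l) ^ k : ℝ) : ℂ) * hankel θ (-1 + k * (-β)) a r)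
      (∫ r in Ioi (0 : ℝ), hankel θ (β - 1) a r * (l + ray θ a r ^ (β : ℂ))⁻¹) := by
  have hθ0 : 0 < θ := by linarith [Real.pi_pos]
  have hsum : ∀ r : ℝ, HasSum (fun k : ℕ => ‖hankel θ (-1) a r‖ * (1 / 2 : ℝ) ^ k)
      (‖hankel θ (-1) a r‖ * 2) := fun r => hasSum_geometric_two.mul_left _
  have hratio : ∀ r ∈ Ioi (0 : ℝ), ‖-l * ray θ a r ^ ((-β : ℝ) : ℂ)‖ ≤ 1 / 2 := by
    intro r hr
    have hm0 : 0 < a * Real.sin θ := mul_pos ha (sin_pos_of_obtuse hθ2 hθ)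
    have h1 : (a * Real.sin θ) ^ β ≤ ‖ray θ a r‖ ^ β :=
      Real.rpow_le_rpow hm0.le (mul_sin_le_norm_ray θ a r) hβ.le
    rw [norm_mul, norm_neg, Complex.norm_real, Real.norm_of_nonneg hl.le, Complex.norm_cpow_real,
      Real.rpow_neg (norm_nonneg _), ← div_eq_mul_inv, div_le_iff₀ (by linarith)]
    linarith
  refine hasSum_integral_of_dominated_convergence
    (fun k r => ‖hankel θ (-1) a r‖ * (1 / 2 : ℝ) ^ k) ?_ ?_ ?_ ?_ ?_
  · exact fun k => ((measurable_hankel θ _ a).const_mul _).aestronglyMeasurable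
  · intro k
    filter_upwards [ae_restrict_mem measurableSet_Ioi] with r hr
    have hs := ray_mem_slitPlane (a := a) hθ0 hθ (le_of_lt hr) (by linarith [mem_Ioi.1 hr])
    have h1 := pow_le_pow_left₀ (norm_nonneg _) (hratio r hr) k
    rw [hankel_add_mul (Complex.slitPlane_ne_zero hs), mul_left_comm, Complex.ofReal_pow,
      ← mul_pow, norm_mul, norm_pow, Complex.ofReal_neg]
    gcongr
  · exact ae_of_all _ fun r => (hsum r).summable
  · simp_rw [fun r => (hsum r).tsum_eq]
    exact (integrableOn_hankel hθ2 hθ _ ha).norm.mul_const 2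
  · filter_upwards [ae_restrict_mem measurableSet_Ioi] with r hr
    have hs := ray_mem_slitPlane (a := a) hθ0 hθ (le_of_lt hr) (by linarith [mem_Ioi.1 hr])
    have h0 := Complex.slitPlane_ne_zero hs
    have h1 := (hasSum_geometric_of_norm_lt_one ((hratio r hr).trans_lt one_half_lt_one)).mul_left
      (hankel θ (-1) a r)
    have hp : ray θ a r ^ (β : ℂ) ≠ 0 := by simp [Complex.cpow_eq_zero_iff, h0]
    have hn : ray θ a r ^ ((-β : ℝ) : ℂ) = (ray θ a r ^ (β : ℂ))⁻¹ := by
      rw [Complex.ofReal_neg, Complex.cpow_neg]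
    have h2 : hankel θ (β - 1) a r = hankel θ (-1) a r * ray θ a r ^ (β : ℂ) := by
      have := hankel_add_mul h0 (-1) β 1
      rw [pow_one, Nat.cast_one, one_mul] at this
      rw [← this]
      congr 1
      ring
    have h3 : hankel θ (β - 1) a r * (l + ray θ a r ^ (β : ℂ))⁻¹ =
        hankel θ (-1) a r * (1 - -l * ray θ a r ^ ((-β : ℝ) : ℂ))⁻¹ := by
      rw [h2, hn, mul_assoc]
      congr 1
      rw [show 1 - -(l : ℂ) * (ray θ a r ^ (β : ℂ))⁻¹ =
        (l + ray θ a r ^ (β : ℂ)) * (ray θ a r ^ (β : ℂ))⁻¹ by field_simp; ring, mul_inv, inv_inv,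
        mul_comm]
    rw [h3]
    refine h1.congr_fun fun k => ?_
    rw [hankel_add_mul h0, mul_pow]
    push_cast
    ring

/-- The Laplace transform of the Wright function is the Mittag-Leffler function. -/
theorem hasSum_laplace_wright {β : ℝ} (hβ0 : 0 < β) (hβ1 : β < 1) {l : ℝ} (hl : 0 < l) :
    HasSum (fun k : ℕ => (-l) ^ k / Real.Gamma (β * k + 1))
      (∫ x in Ioi (0 : ℝ), Real.exp (-l * x) *
        ∑' k : ℕ, (-x) ^ k / ((k.factorial : ℝ) * Real.Gamma (1 - β * (k + 1)))) := by
  obtain ⟨θ, hθ2, hθ, hβθ⟩ : ∃ θ : ℝ, π / 2 < θ ∧ θ < π ∧ θ * β ≤ π / 2 := by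
    have hp := Real.pi_pos
    refine ⟨π / (1 + β), ?_, ?_, ?_⟩
    · rw [div_lt_div_iff₀ (by norm_num) (by linarith)]; nlinarith
    · rw [div_lt_iff₀ (by linarith)]; nlinarith
    · rw [div_mul_eq_mul_div, div_le_div_iff₀ (by linarith) (by norm_num)]; nlinarith
  have hs := sin_pos_of_obtuse hθ2 hθ
  set a := (2 * l) ^ (1 / β) / Real.sin θ with ha'
  have ha : 0 < a := by positivity
  have hal : 2 * l ≤ (a * Real.sin θ) ^ β := by
    rw [ha', div_mul_cancel₀ _ hs.ne', ← Real.rpow_mul (by positivity),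
      one_div_mul_cancel hβ0.ne', Real.rpow_one]
  simp_rw [fun x => (hasSum_wright hθ2 hθ hβ0 hβ1 ha x).tsum_eq]
  rw [integral_exp_mul_wright hθ2 hθ hβ0 hβθ ha hl]
  have h := hasSum_integral_hankel_resolvent hθ2 hθ hβ0 ha hl hal
  have h2 := ((Complex.hasSum_im (h.mul_left (Complex.exp (θ * Complex.I)))).mul_left π⁻¹)
  refine h2.congr_fun fun k => ?_
  rw [integral_const_mul, mul_left_comm, Complex.im_ofReal_mul]
  have e := hankelIm_eq_inv_Gamma hθ2 hθ (-1 + k * (-β)) ha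
  rw [hankelIm, show -(-1 + k * (-β)) = β * k + 1 by ring] at e
  rw [e]
  field_simp

theorem integral_rpow_mul_sub_rpow {a b t : ℝ} (ha : 0 < a) (hb : 0 < b) (ht : 0 < t) :
    ∫ τ in (0 : ℝ)..t, (t - τ) ^ (b - 1) * τ ^ (a - 1) =
      t ^ (a + b - 1) * (Real.Gamma a * Real.Gamma b / Real.Gamma (a + b)) := by
  have h := Complex.betaIntegral_scaled (a : ℂ) (b : ℂ) ht
  rw [Complex.betaIntegral_eq_Gamma_mul_div _ _ (by simpa) (by simpa)] at h
  apply Complex.ofReal_injective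
  rw [← intervalIntegral.integral_ofReal]
  push_cast [Complex.ofReal_cpow ht.le, ← Complex.Gamma_ofReal]
  rw [← h]
  refine intervalIntegral.integral_congr fun τ hτ => ?_
  rw [uIcc_of_le ht.le] at hτ
  have h1 : 0 ≤ t - τ := sub_nonneg.2 hτ.2
  rw [Complex.ofReal_cpow h1, Complex.ofReal_cpow hτ.1]
  push_cast
  ring

theorem intervalIntegrable_rpow_mul_sub_rpow {a b t : ℝ} (ha : 0 < a) (hb : 0 < b) (ht : 0 < t) :
    IntervalIntegrable (fun τ : ℝ => (t - τ) ^ (b - 1) * τ ^ (a - 1)) volume 0 t := by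
  refine intervalIntegral.intervalIntegrable_of_integral_ne_zero ?_
  rw [integral_rpow_mul_sub_rpow ha hb ht]
  have := Real.Gamma_pos_of_pos ha
  have := Real.Gamma_pos_of_pos hb
  have := Real.Gamma_pos_of_pos (add_pos ha hb)
  have := Real.rpow_pos_of_pos ht (a + b - 1)
  positivity

theorem Gamma_mul_natCast_add_one_pos {β : ℝ} (hβ : 0 < β) (k : ℕ) :
    0 < Real.Gamma (β * k + 1) :=
  Real.Gamma_pos_of_pos (by positivity)

theorem summable_pow_div_Gamma {β : ℝ} (hβ0 : 0 < β) (hβ1 : β < 1) {R : ℝ} (hR : 0 < R) :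
    Summable fun k : ℕ => R ^ k / Real.Gamma (β * k + 1) := by
  refine (hasSum_laplace_wright hβ0 hβ1 hR).summable.abs.congr fun k => ?_
  rw [abs_div, abs_pow, abs_neg, abs_of_pos hR, abs_of_pos (Gamma_mul_natCast_add_one_pos hβ0 k)]

theorem hasDerivAt_mittagLeffler {β : ℝ} (hβ0 : 0 < β) (hβ1 : β < 1) (z : ℝ) :
    HasDerivAt (mittagLeffler β 1)
      (∑' k : ℕ, k * z ^ (k - 1) / Real.Gamma (β * k + 1)) z := by
  have hR : 0 < |z| + 1 := by positivity
  refine hasDerivAt_tsum_of_isPreconnected (t := Metric.ball 0 (|z| + 1)) (y₀ := 0)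
    (u := fun k : ℕ => (2 * (|z| + 1)) ^ k / Real.Gamma (β * k + 1))
    (g := fun (k : ℕ) (y : ℝ) => y ^ k / Real.Gamma (β * k + 1))
    (g' := fun (k : ℕ) (y : ℝ) => k * y ^ (k - 1) / Real.Gamma (β * k + 1))
    (summable_pow_div_Gamma hβ0 hβ1 (by positivity)) Metric.isOpen_ball
    (convex_ball _ _).isPreconnected (fun k y _ => (hasDerivAt_pow k y).div_const _)
    (fun k y hy => ?_) (Metric.mem_ball_self hR) ?_ (by simp)
  · have hy' : |y| ≤ |z| + 1 := by simpa using (mem_ball_zero_iff.1 hy).le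
    rw [norm_div, norm_mul, norm_pow, Real.norm_of_nonneg (Gamma_mul_natCast_add_one_pos hβ0 k).le,
      Real.norm_natCast, Real.norm_eq_abs, mul_pow]
    have hk : (k : ℝ) ≤ 2 ^ k := by exact_mod_cast k.lt_two_pow_self.le
    have h2 : |y| ^ (k - 1) ≤ (|z| + 1) ^ k :=
      (pow_le_pow_left₀ (abs_nonneg y) hy' _).trans
        (pow_le_pow_right₀ (by linarith [abs_nonneg z]) (Nat.sub_le k 1))
    have := Gamma_mul_natCast_add_one_pos hβ0 k
    gcongr
  · exact summable_of_ne_finset_zero (s := {0}) fun k hk => by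
      simp only [Finset.mem_singleton] at hk
      simp [hk]

theorem deriv_mittagLeffler_rpow {β : ℝ} (hβ0 : 0 < β) (hβ1 : β < 1) (lam : ℝ) {τ : ℝ}
    (hτ : 0 < τ) :
    deriv (fun s : ℝ => mittagLeffler β 1 (-lam * s ^ β)) τ =
      ∑' k : ℕ, (-lam) ^ (k + 1) / Real.Gamma (β * (k + 1)) * τ ^ (β * (k + 1) - 1) := by
  have h := (hasDerivAt_mittagLeffler hβ0 hβ1 (-lam * τ ^ β)).comp τ
    ((Real.hasDerivAt_rpow_const (p := β) (Or.inl hτ.ne')).const_mul (-lam))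
  refine h.deriv.trans ?_
  rw [← tsum_mul_right, ← (add_left_injective 1).tsum_eq]
  · refine tsum_congr fun k => ?_
    have hk : β * (k + 1) ≠ 0 := by positivity
    have hG : Real.Gamma (β * (k + 1)) ≠ 0 := (Real.Gamma_pos_of_pos (by positivity)).ne'
    have hτk : τ ^ (β * (k + 1) - 1) = (τ ^ β) ^ k * τ ^ (β - 1) := by
      rw [← Real.rpow_natCast, ← Real.rpow_mul hτ.le, ← Real.rpow_add hτ]
      ring_nf
    rw [hτk]
    push_cast
    rw [Real.Gamma_add_one hk, mul_pow, pow_succ]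
    field_simp
  · intro k hk
    cases k with
    | zero => simp at hk
    | succ k => exact ⟨k, rfl⟩

theorem caputo_mittagLeffler {β : ℝ} (hβ0 : 0 < β) (hβ1 : β < 1) {lam : ℝ} (hlam : 0 < lam)
    {t : ℝ} (ht : 0 < t) :
    caputo β (fun s : ℝ => mittagLeffler β 1 (-lam * s ^ β)) t =
      -lam * mittagLeffler β 1 (-lam * t ^ β) := by
  have hb : 0 < 1 - β := by linarith
  have hΓb := Real.Gamma_pos_of_pos hb
  have hpos : ∀ k : ℕ, 0 < β * (k + 1) := fun k => by positivity
  have hbeta : ∀ k : ℕ, ∫ τ in Ioc 0 t, (t - τ) ^ (-β) * τ ^ (β * (k + 1) - 1) =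
      (t ^ β) ^ k * (Real.Gamma (β * (k + 1)) * Real.Gamma (1 - β) / Real.Gamma (β * k + 1)) := by
    intro k
    have h := integral_rpow_mul_sub_rpow (hpos k) hb ht
    rw [intervalIntegral.integral_of_le ht.le, show 1 - β - 1 = -β by ring,
      show β * (k + 1) + (1 - β) = β * k + 1 by ring, add_sub_cancel_right, Real.rpow_mul ht.le,
      Real.rpow_natCast] at h
    exact h
  have hint : ∀ k : ℕ, IntegrableOn (fun τ : ℝ => (t - τ) ^ (-β) * τ ^ (β * (k + 1) - 1))
      (Ioc 0 t) := by
    intro k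
    have h := intervalIntegrable_rpow_mul_sub_rpow (hpos k) hb ht
    rwa [intervalIntegrable_iff_integrableOn_Ioc_of_le ht.le, show 1 - β - 1 = -β by ring] at h
  set c : ℕ → ℝ := fun k => (-lam) ^ (k + 1) / Real.Gamma (β * (k + 1)) with hc
  have hmain := hasSum_integral_of_summable_integral_norm
    (F := fun (k : ℕ) τ => c k * ((t - τ) ^ (-β) * τ ^ (β * (k + 1) - 1)))
    (fun k => (hint k).const_mul (c k)) (μ := volume.restrict (Ioc 0 t)) ?_
  · have hval : ∫ τ in (0 : ℝ)..t, (t - τ) ^ (-β) *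
        deriv (fun s : ℝ => mittagLeffler β 1 (-lam * s ^ β)) τ =
        ∫ τ in Ioc 0 t, ∑' k, c k * ((t - τ) ^ (-β) * τ ^ (β * (k + 1) - 1)) := by
      rw [intervalIntegral.integral_of_le ht.le]
      refine setIntegral_congr_fun measurableSet_Ioc fun τ hτ => ?_
      rw [deriv_mittagLeffler_rpow hβ0 hβ1 lam hτ.1, ← tsum_mul_left]
      exact tsum_congr fun k => mul_left_comm _ _ _
    rw [caputo, hval, ← hmain.tsum_eq, mittagLeffler, ← tsum_mul_left, ← tsum_mul_left]
    refine tsum_congr fun k => ?_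
    rw [integral_const_mul, hbeta k, hc]
    have h1 := (Real.Gamma_pos_of_pos (hpos k)).ne'
    have h2 := (Gamma_mul_natCast_add_one_pos hβ0 k).ne'
    have h3 := hΓb.ne'
    simp only [mul_pow, pow_succ]
    field_simp
  · refine ((summable_pow_div_Gamma hβ0 hβ1 (R := lam * t ^ β) (by positivity)).mul_left
      (lam * Real.Gamma (1 - β))).congr fun k => ?_
    have hn : ∀ τ ∈ Ioc 0 t, ‖c k * ((t - τ) ^ (-β) * τ ^ (β * (k + 1) - 1))‖ =
        |c k| * ((t - τ) ^ (-β) * τ ^ (β * (k + 1) - 1)) := fun τ hτ => by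
      rw [norm_mul, Real.norm_eq_abs, Real.norm_of_nonneg]
      exact mul_nonneg (Real.rpow_nonneg (sub_nonneg.2 hτ.2) _) (Real.rpow_nonneg hτ.1.le _)
    rw [setIntegral_congr_fun measurableSet_Ioc hn, integral_const_mul, hbeta k, hc]
    have h1 := Real.Gamma_pos_of_pos (hpos k)
    have h2 := (Gamma_mul_natCast_add_one_pos hβ0 k).ne'
    simp only
    rw [abs_div, abs_pow, abs_neg, abs_of_pos hlam, abs_of_pos h1, mul_pow, pow_succ]
    have h3 := h1.ne'
    field_simp

theorem integral_exp_mul_wrightG {β : ℝ} (hβ0 : 0 < β) (hβ1 : β < 1) {lam : ℝ} (hlam : 0 < lam)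
    {t : ℝ} (ht : 0 < t) :
    ∫ x in Ioi (0 : ℝ), Real.exp (-lam * x) * wrightG β x t =
      mittagLeffler β 1 (-lam * t ^ β) := by
  have hs : 0 < t ^ β := Real.rpow_pos_of_pos ht β
  have h := (hasSum_laplace_wright hβ0 hβ1 (mul_pos hlam hs)).tsum_eq
  rw [mittagLeffler, neg_mul, h]
  have h2 := integral_comp_mul_left_Ioi (fun y => Real.exp (-(lam * t ^ β) * y) *
    ∑' k : ℕ, (-y) ^ k / ((k.factorial : ℝ) * Real.Gamma (1 - β * (k + 1)))) 0 (inv_pos.2 hs)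
  rw [mul_zero, inv_inv, smul_eq_mul, ← inv_mul_eq_iff_eq_mul₀ hs.ne', ← integral_const_mul] at h2
  rw [← h2]
  refine integral_congr_ae (ae_of_all _ fun x => ?_)
  have h3 : -(lam * t ^ β) * ((t ^ β)⁻¹ * x) = -lam * x := by field_simp
  simp only [h3, wrightG, Real.rpow_neg ht.le, mul_left_comm, div_eq_inv_mul, mul_neg]

theorem fractional_RC_circuit (β lam V0 : ℝ) (hβ0 : 0 < β) (hβ1 : β < 1) (hlam : 0 < lam)
    (V : ℝ → ℝ) (hV : ∀ t : ℝ, V t = V0 * mittagLeffler β 1 (-lam * t ^ β)) :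
    (∀ t : ℝ, 0 < t → caputo β V t + lam * V t = 0) ∧
    V 0 = V0 ∧
    (∀ t : ℝ, 0 < t →
      V t = ∫ x in Set.Ioi (0:ℝ), V0 * Real.exp (-lam * x) * wrightG β x t) := by
  refine ⟨fun t ht => ?_, ?_, fun t ht => ?_⟩
  · have h1 : caputo β V t =
        V0 * caputo β (fun s : ℝ => mittagLeffler β 1 (-lam * s ^ β)) t := by
      simp only [caputo, funext hV, deriv_const_mul_field', mul_left_comm _ V0,
        intervalIntegral.integral_const_mul]
    rw [h1, caputo_mittagLeffler hβ0 hβ1 hlam ht, hV]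
    ring
  · rw [hV, Real.zero_rpow hβ0.ne', mul_zero, mittagLeffler,
      tsum_eq_single 0 fun k hk => by simp [hk]]
    simp
  · rw [hV, ← integral_exp_mul_wrightG hβ0 hβ1 hlam ht, ← integral_const_mul]
    simp only [mul_assoc]
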